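/- Let q be a positive integer, Q = 2^q, let a < b be real numbers, write |I| = b − a, and let H be a real number with 1 ≤ H ≤ |I|. Set H_j = H^{2^{j−q}} for j = 1, …, q (so H_q = H, H_{q−1} = H^{1/2}, …, H₁ = H^{2/Q}). For f : ℝ → ℝ let S = ∑_{a < n ≤ b} e(f(n)) (n ranging over integers); for a tuple h = (h₁, …, h_q) of positive integers let f_q(n; h) = ∑_{ε ∈ {0,1}^q} (−1)^{q − (ε₁+⋯+ε_q)} · f(n + ε₁h₁ + ⋯ + ε_q h_q) be the q-fold finite difference, and let S_q(h) = ∑_{a < n ≤ b − h₁ − ⋯ − h_q} e(f_q(n; h)). Then |S|^Q ≤ 8^{Q−1} · ( |I|^Q / H + (|I|^{Q−1} / (H₁·H₂·⋯·H_q)) · ∑_{1 ≤ h₁ ≤ H₁} ⋯ ∑_{1 ≤ h_q ≤ H_q} |S_q(h)| ). -/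

import Mathlib

open Real

/-- `e(t) = exp(2πit)` -/
noncomputable def e (t : ℝ) : ℂ := Complex.exp (2 * Real.pi * Complex.I * t)

open scoped Classical in
/-- the `q`-fold finite difference of `f` with steps `h₁, …, h_q` -/
noncomputable def fdiff (q : ℕ) (f : ℝ → ℝ) (h : Fin q → ℕ) (n : ℤ) : ℝ :=
  ∑ ε : Fin q → Bool,
    (-1 : ℝ) ^ (q - (Finset.univ.filter fun i => ε i).card) *
      f ((n : ℝ) + ∑ i, if ε i then (h i : ℝ) else 0)

lemma e_zero_norm (t : ℝ) : ‖e t‖ = 1 := by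
  unfold e
  rw [Complex.norm_exp]
  simp

lemma e_sub_conj (s t : ℝ) : e (s - t) = e s * (starRingEnd ℂ) (e t) := by
  unfold e
  rw [← Complex.exp_conj, ← Complex.exp_add]
  congr 1
  have h2 : (starRingEnd ℂ) 2 = 2 := Complex.conj_ofNat 2
  simp [h2]
  ring

/-- correlation of the truncated sequence -/
lemma vdc_corr (z : ℤ → ℂ) (A B : ℤ) (K : ℕ) (j k : ℕ) (hj : j < K) (hk : k ≤ j) :
    ∑ m ∈ Finset.Ioc (A - K + 1) B,
      (if m + j ∈ Finset.Ioc A B then z (m + j) else 0) *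
        (starRingEnd ℂ) (if m + k ∈ Finset.Ioc A B then z (m + k) else 0)
      = ∑ n ∈ Finset.Ioc A (B - (j - k : ℕ)),
          z (n + (j - k : ℕ)) * (starRingEnd ℂ) (z n) := by
  symm
  have h1 : ∑ m ∈ Finset.Ioc (A - K + 1) B,
      (if m + j ∈ Finset.Ioc A B then z (m + j) else 0) *
        (starRingEnd ℂ) (if m + k ∈ Finset.Ioc A B then z (m + k) else 0)
      = ∑ m ∈ (Finset.Ioc (A - K + 1) B).filter
          (fun m : ℤ => m + j ∈ Finset.Ioc A B ∧ m + k ∈ Finset.Ioc A B),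
          z (m + j) * (starRingEnd ℂ) (z (m + k)) := by
    rw [Finset.sum_filter]
    refine Finset.sum_congr rfl fun m _ => ?_
    by_cases h : m + j ∈ Finset.Ioc A B <;> by_cases h' : m + k ∈ Finset.Ioc A B <;> simp [h, h']
  rw [h1]
  refine Finset.sum_nbij' (fun n => n - k) (fun m => m + k) ?_ ?_ ?_ ?_ ?_
  · intro n hn
    simp only [Finset.mem_Ioc, Finset.mem_filter] at *
    omega
  · intro n hn
    simp only [Finset.mem_Ioc, Finset.mem_filter] at *
    omega
  · intro n _; simp
  · intro n _; simp
  · intro n _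
    have : n + ((j - k : ℕ) : ℤ) = n - k + j := by omega
    rw [this]; simp

lemma sum_split (K : ℕ) (c : ℕ → ℝ) (hc : ∀ d, 0 ≤ c d) :
    ∑ j ∈ Finset.range K, ∑ k ∈ Finset.range K, c (max j k - min j k)
      ≤ K * (c 0 + 2 * ∑ d ∈ Finset.Icc 1 (K - 1), c d) := by
  have : ∀ j ∈ Finset.range K, ∑ k ∈ Finset.range K, c (max j k - min j k)
      ≤ c 0 + 2 * ∑ d ∈ Finset.Icc 1 (K - 1), c d := by
    intro j hj
    rw [Finset.mem_range] at hj
    have e1 : ∑ k ∈ Finset.range K, c (max j k - min j k)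
      = ∑ k ∈ (Finset.range K).filter (fun k => k < j), c (j - k) +
        (∑ k ∈ (Finset.range K).filter (fun k => j < k), c (k - j) + c 0) := by
      rw [Finset.sum_filter, Finset.sum_filter]
      have : c 0 = ∑ k ∈ Finset.range K, if k = j then c 0 else 0 := by simp [hj]
      rw [this, ← Finset.sum_add_distrib, ← Finset.sum_add_distrib]
      refine Finset.sum_congr rfl fun k _ => ?_
      rcases lt_trichotomy k j with h | h | h
      · rw [max_eq_left h.le, min_eq_right h.le]
        simp [h, h.ne, h.not_gt]
      · simp [h]
      · rw [max_eq_right h.le, min_eq_left h.le]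
        simp [h, h.ne', h.not_gt]
    have e2 : ∑ k ∈ (Finset.range K).filter (fun k => k < j), c (j - k)
        ≤ ∑ d ∈ Finset.Icc 1 (K - 1), c d := by
      rw [← Finset.sum_image (s := (Finset.range K).filter (fun k => k < j))
        (g := fun k => j - k) (f := c)]
      · refine Finset.sum_le_sum_of_subset_of_nonneg ?_ fun d _ _ => hc d
        intro d hd
        simp only [Finset.mem_image, Finset.mem_filter, Finset.mem_range, Finset.mem_Icc] at *
        omega
      · intro x hx y hy h
        simp only [Finset.coe_filter, Finset.mem_range, Set.mem_ofPred_eq] at *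
        omega
    have e3 : ∑ k ∈ (Finset.range K).filter (fun k => j < k), c (k - j)
        ≤ ∑ d ∈ Finset.Icc 1 (K - 1), c d := by
      rw [← Finset.sum_image (s := (Finset.range K).filter (fun k => j < k))
        (g := fun k => k - j) (f := c)]
      · refine Finset.sum_le_sum_of_subset_of_nonneg ?_ fun d _ _ => hc d
        intro d hd
        simp only [Finset.mem_image, Finset.mem_filter, Finset.mem_range, Finset.mem_Icc] at *
        omega
      · intro x hx y hy h
        simp only [Finset.coe_filter, Finset.mem_range, Set.mem_ofPred_eq] at *
        omega
    linarith
  calc _ ≤ ∑ j ∈ Finset.range K, (c 0 + 2 * ∑ d ∈ Finset.Icc 1 (K - 1), c d) :=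
        Finset.sum_le_sum this
    _ = _ := by rw [Finset.sum_const, Finset.card_range, nsmul_eq_mul]

lemma vdc_int (z : ℤ → ℂ) (hz : ∀ n, ‖z n‖ ≤ 1) (A B : ℤ) (hAB : A ≤ B) (K : ℕ) (hK : 1 ≤ K) :
    (K : ℝ) * ‖∑ n ∈ Finset.Ioc A B, z n‖ ^ 2 ≤
      ((B - A : ℤ) + K - 1 : ℝ) * ((B - A : ℤ) +
        2 * ∑ d ∈ Finset.Icc 1 (K - 1),
          ‖∑ n ∈ Finset.Ioc A (B - (d : ℕ)), z (n + (d : ℕ)) * (starRingEnd ℂ) (z n)‖) := by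
  set c : ℕ → ℝ := fun d =>
    ‖∑ n ∈ Finset.Ioc A (B - (d : ℕ)), z (n + (d : ℕ)) * (starRingEnd ℂ) (z n)‖ with hc
  set w : ℤ → ℂ := fun n => if n ∈ Finset.Ioc A B then z n else 0 with hw
  set M := Finset.Ioc (A - K + 1) B with hM
  have hcard : (M.card : ℝ) = ((B - A : ℤ) + K - 1 : ℝ) := by
    rw [hM, Int.card_Ioc]
    have : ((B - (A - K + 1)).toNat : ℤ) = B - A + K - 1 := by omega
    have h2 : (((B - (A - K + 1)).toNat : ℤ) : ℝ) = ((B - A + K - 1 : ℤ) : ℝ) := by rw [this]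
    push_cast at h2 ⊢
    exact h2
  have hKS : (K : ℂ) * ∑ n ∈ Finset.Ioc A B, z n
      = ∑ m ∈ M, ∑ k ∈ Finset.range K, w (m + k) := by
    rw [Finset.sum_comm]
    have : ∀ k ∈ Finset.range K, ∑ m ∈ M, w (m + k) = ∑ n ∈ Finset.Ioc A B, z n := by
      intro k hk
      rw [Finset.mem_range] at hk
      rw [hw, ← Finset.sum_filter]
      refine Finset.sum_nbij' (fun n => n + k) (fun m => m - k) ?_ ?_ ?_ ?_ ?_
      · intro n hn
        simp only [hM, Finset.mem_Ioc, Finset.mem_filter] at *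
        omega
      · intro n hn
        simp only [hM, Finset.mem_Ioc, Finset.mem_filter] at *
        omega
      · intro n _; simp
      · intro n _; simp
      · intro n _; rfl
    rw [Finset.sum_congr rfl this]
    simp
  have hc0 : c 0 ≤ (B - A : ℤ) := by
    have hb : ((Finset.Ioc A B).card : ℝ) = ((B - A : ℤ) : ℝ) := by
      rw [Int.card_Ioc]
      have : ((B - A).toNat : ℤ) = B - A := by omega
      exact_mod_cast this
    rw [hc, ← hb]
    simp only [Nat.cast_zero, sub_zero, add_zero]
    refine (norm_sum_le _ _).trans ?_
    calc _ ≤ ∑ n ∈ Finset.Ioc A B, (1 : ℝ) := by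
          refine Finset.sum_le_sum fun n _ => ?_
          rw [norm_mul, RCLike.norm_conj]
          exact mul_le_one₀ (hz n) (norm_nonneg _) (hz n)
      _ = _ := by simp
  have hsq : ∑ m ∈ M, ‖∑ k ∈ Finset.range K, w (m + k)‖ ^ 2 ≤
      ∑ j ∈ Finset.range K, ∑ k ∈ Finset.range K, c (max j k - min j k) := by
    have h1 : ((∑ m ∈ M, ‖∑ k ∈ Finset.range K, w (m + k)‖ ^ 2 : ℝ) : ℂ)
        = ∑ j ∈ Finset.range K, ∑ k ∈ Finset.range K,
            ∑ m ∈ M, w (m + j) * (starRingEnd ℂ) (w (m + k)) := by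
      push_cast
      calc _ = ∑ m ∈ M, ∑ j ∈ Finset.range K, ∑ k ∈ Finset.range K,
            w (m + j) * (starRingEnd ℂ) (w (m + k)) := by
            refine Finset.sum_congr rfl fun m _ => ?_
            rw [← Complex.mul_conj', map_sum, Finset.sum_mul_sum]
        _ = _ := by
            rw [Finset.sum_comm]
            refine Finset.sum_congr rfl fun j _ => ?_
            rw [Finset.sum_comm]
    have h0 : 0 ≤ ∑ m ∈ M, ‖∑ k ∈ Finset.range K, w (m + k)‖ ^ 2 :=
      Finset.sum_nonneg fun _ _ => by positivity
    have h2 := congrArg norm h1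
    rw [Complex.norm_real, Real.norm_of_nonneg h0] at h2
    rw [h2]
    refine (norm_sum_le _ _).trans (Finset.sum_le_sum fun j hj => ?_)
    refine (norm_sum_le _ _).trans (Finset.sum_le_sum fun k hk => ?_)
    rw [Finset.mem_range] at hj hk
    rcases le_total k j with h | h
    · rw [max_eq_left h, min_eq_right h, hc]
      exact (congrArg norm (vdc_corr z A B K j k hj h)).le
    · rw [max_eq_right h, min_eq_left h, hc]
      have h3 := vdc_corr z A B K k j hk h
      have h4 : ‖∑ m ∈ M, w (m + j) * (starRingEnd ℂ) (w (m + k))‖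
          = ‖∑ m ∈ M, w (m + k) * (starRingEnd ℂ) (w (m + j))‖ := by
        rw [← RCLike.norm_conj (∑ m ∈ M, w (m + j) * (starRingEnd ℂ) (w (m + k))), map_sum]
        congr 1
        refine Finset.sum_congr rfl fun m _ => ?_
        simp [mul_comm]
      rw [h4]
      exact (congrArg norm h3).le
  have hcs : ‖(K : ℂ) * ∑ n ∈ Finset.Ioc A B, z n‖ ^ 2 ≤
      M.card * ∑ m ∈ M, ‖∑ k ∈ Finset.range K, w (m + k)‖ ^ 2 := by
    rw [hKS]
    refine le_trans ?_ sq_sum_le_card_mul_sum_sq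
    gcongr
    exact norm_sum_le _ _
  have hss := sum_split K c (fun d => norm_nonneg _)
  have hKpos : (0 : ℝ) < K := by exact_mod_cast hK
  rw [norm_mul, mul_pow, Complex.norm_natCast] at hcs
  have hfin : (K : ℝ) ^ 2 * ‖∑ n ∈ Finset.Ioc A B, z n‖ ^ 2 ≤
      M.card * (K * ((B - A : ℤ) + 2 * ∑ d ∈ Finset.Icc 1 (K - 1), c d)) := by
    refine hcs.trans ?_
    gcongr
    refine hsq.trans (hss.trans ?_)
    gcongr
  rw [hcard] at hfin
  refine le_of_mul_le_mul_left ?_ hKpos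
  calc _ = (K : ℝ) ^ 2 * ‖∑ n ∈ Finset.Ioc A B, z n‖ ^ 2 := by ring
    _ ≤ _ := hfin
    _ = _ := by ring

lemma vdc_real (z : ℤ → ℂ) (hz : ∀ n, ‖z n‖ ≤ 1) (A B : ℤ) (L H : ℝ) (hH : 1 ≤ H) (hHL : H ≤ L)
    (hN : ((B - A : ℤ) : ℝ) ≤ L + 1) :
    ‖∑ n ∈ Finset.Ioc A B, z n‖ ^ 2 ≤ (4 * L ^ 2 + 4 * L *
        ∑ d ∈ Finset.Icc 1 ⌊H⌋₊,
          ‖∑ n ∈ Finset.Ioc A (B - (d : ℕ)), z (n + (d : ℕ)) * (starRingEnd ℂ) (z n)‖) / H := by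
  set s := ∑ d ∈ Finset.Icc 1 ⌊H⌋₊,
          ‖∑ n ∈ Finset.Ioc A (B - (d : ℕ)), z (n + (d : ℕ)) * (starRingEnd ℂ) (z n)‖ with hs
  have hs0 : 0 ≤ s := Finset.sum_nonneg fun _ _ => norm_nonneg _
  have hL : 0 ≤ L := by linarith
  rcases le_or_gt A B with hAB | hAB
  · have h := vdc_int z hz A B hAB (⌊H⌋₊ + 1) (by omega)
    rw [Nat.add_sub_cancel, ← hs] at h
    set K : ℝ := ((⌊H⌋₊ + 1 : ℕ) : ℝ) with hK
    have hKH : H ≤ K := by rw [hK]; push_cast; exact (Nat.lt_floor_add_one H).le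
    have hN0 : (0 : ℝ) ≤ ((B - A : ℤ) : ℝ) := by exact_mod_cast (by omega : 0 ≤ B - A)
    set N : ℝ := ((B - A : ℤ) : ℝ)
    set T := ‖∑ n ∈ Finset.Ioc A B, z n‖ ^ 2
    have hKpos : 0 < K := by linarith
    rw [le_div_iff₀ (by linarith)]
    have h1 : (N + K - 1) * H ≤ 2 * L * K := by nlinarith
    have h2 : N + 2 * s ≤ 2 * L + 2 * s := by linarith
    refine le_of_mul_le_mul_left ?_ hKpos
    calc K * (T * H) = (K * T) * H := by ring
      _ ≤ ((N + K - 1) * (N + 2 * s)) * H := by gcongr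
      _ = ((N + K - 1) * H) * (N + 2 * s) := by ring
      _ ≤ (2 * L * K) * (2 * L + 2 * s) := by gcongr
      _ = _ := by ring
  · rw [Finset.Ioc_eq_empty_of_le hAB.le]
    rw [Finset.sum_empty, norm_zero, zero_pow two_ne_zero]
    exact div_nonneg (by positivity) (by linarith)

lemma fdiff_eq (q : ℕ) (f : ℝ → ℝ) (h : Fin q → ℕ) (n : ℤ) :
    fdiff q f h n = ∑ ε : Fin q → Bool, (∏ i, if ε i then (1 : ℝ) else -1) *
      f ((n : ℝ) + ∑ i, if ε i then (h i : ℝ) else 0) := by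
  unfold fdiff
  refine Finset.sum_congr rfl fun ε _ => ?_
  congr 1
  rw [Finset.prod_ite, Finset.prod_const_one, one_mul, Finset.prod_const]
  congr 1
  have := Finset.card_filter_add_card_filter_not (s := (Finset.univ : Finset (Fin q)))
    (fun i => ε i = true)
  rw [Finset.card_univ, Fintype.card_fin] at this
  have h2 : (Finset.univ.filter fun i => ε i = true).card ≤ q := by omega
  convert_to _ = _
  omega

lemma fdiff_zero (f : ℝ → ℝ) (h : Fin 0 → ℕ) (n : ℤ) : fdiff 0 f h n = f n := by
  rw [fdiff_eq]; simp

lemma fdiff_succ (q : ℕ) (f : ℝ → ℝ) (h : Fin q → ℕ) (d : ℕ) (n : ℤ) :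
    fdiff (q + 1) f (Fin.snoc h d : Fin (q + 1) → ℕ) n
      = fdiff q f h (n + d) - fdiff q f h n := by
  rw [fdiff_eq, fdiff_eq, fdiff_eq]
  rw [← (Fin.snocEquiv (fun _ : Fin (q + 1) => Bool)).sum_comp, Fintype.sum_prod_type]
  simp only [Fintype.sum_bool, Fin.snocEquiv_apply, Fin.prod_univ_castSucc, Fin.sum_univ_castSucc,
    Fin.snoc_castSucc, Fin.snoc_last]
  rw [sub_eq_add_neg, ← Finset.sum_neg_distrib]
  congr 1
  · refine Finset.sum_congr rfl fun ε _ => ?_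
    simp
    left
    congr 1
    ring
  · refine Finset.sum_congr rfl fun ε _ => ?_
    simp

lemma sum_Icc_snoc (q : ℕ) (M : Fin (q + 1) → ℕ) (F : (Fin (q + 1) → ℕ) → ℝ) :
    ∑ h ∈ Finset.Icc (1 : Fin (q + 1) → ℕ) M, F h =
      ∑ h ∈ Finset.Icc (1 : Fin q → ℕ) (fun i => M i.castSucc),
        ∑ d ∈ Finset.Icc 1 (M (Fin.last q)), F (Fin.snoc h d : Fin (q + 1) → ℕ) := by
  rw [← Finset.sum_product']
  symm
  refine Finset.sum_nbij' (fun p => (Fin.snoc p.1 p.2 : Fin (q + 1) → ℕ))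
    (fun h => (fun i => h i.castSucc, h (Fin.last q))) ?_ ?_ ?_ ?_ ?_
  · rintro ⟨h, d⟩ hp
    simp only [Finset.mem_product, Finset.mem_Icc, Pi.le_def, Fin.forall_fin_succ',
      Fin.snoc_castSucc, Fin.snoc_last, Pi.one_apply] at *
    tauto
  · intro h hp
    simp only [Finset.mem_product, Finset.mem_Icc, Pi.le_def, Fin.forall_fin_succ',
      Pi.one_apply] at *
    tauto
  · rintro ⟨h, d⟩ _
    simp
  · intro h _
    funext i
    refine Fin.lastCases ?_ (fun i => ?_) i <;> simp
  · intros; rfl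

noncomputable def XX (q : ℕ) (a b H : ℝ) (f : ℝ → ℝ) : ℝ :=
  (b - a) ^ (2 ^ q - 1) / (∏ i : Fin q, H ^ ((2 : ℝ) ^ (i.1 + 1) / 2 ^ q)) *
            ∑ h ∈ Finset.Icc (1 : Fin q → ℕ)
                (fun i : Fin q => ⌊H ^ ((2 : ℝ) ^ (i.1 + 1) / 2 ^ q)⌋₊),
              ‖∑ n ∈ Finset.Ioc ⌊a⌋ ⌊b - ∑ i, (h i : ℝ)⌋, e (fdiff q f h n)‖

lemma sqrt_exp (q i : ℕ) (H : ℝ) (hH : 0 ≤ H) :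
    (√H) ^ ((2 : ℝ) ^ (i + 1) / 2 ^ q) = H ^ ((2 : ℝ) ^ (i + 1) / 2 ^ (q + 1)) := by
  rw [Real.sqrt_eq_rpow, ← Real.rpow_mul hH]
  congr 1
  rw [pow_succ 2 q]
  field_simp

lemma core (q : ℕ) (a b H : ℝ) (hH1 : 1 ≤ H) (hHI : H ≤ b - a) (f : ℝ → ℝ) :
    XX q a b (√H) f ^ 2 ≤ 4 * ((b - a) ^ (2 ^ (q + 1)) / H) + 4 * XX (q + 1) a b H f := by
  have hH0 : 0 < H := by linarith
  unfold XX
  rw [sum_Icc_snoc, Fin.prod_univ_castSucc]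
  simp only [sqrt_exp q _ H hH0.le, Fin.val_castSucc, Fin.val_last]
  have hlast : H ^ ((2 : ℝ) ^ (q + 1) / 2 ^ (q + 1)) = H := by
    rw [div_self (by positivity), Real.rpow_one]
  rw [hlast]
  set L := b - a with hL
  have hL0 : 0 < L := by linarith
  set P := ∏ i : Fin q, H ^ ((2 : ℝ) ^ (i.1 + 1) / 2 ^ (q + 1)) with hP
  have hP0 : 0 < P := Finset.prod_pos fun i _ => Real.rpow_pos_of_pos hH0 _
  set D := Finset.Icc (1 : Fin q → ℕ)
    (fun i : Fin q => ⌊H ^ ((2 : ℝ) ^ (i.1 + 1) / 2 ^ (q + 1))⌋₊) with hD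
  have hcard : (D.card : ℝ) ≤ P := by
    rw [hD, Pi.card_Icc]
    push_cast
    rw [hP]
    refine Finset.prod_le_prod (fun _ _ => by positivity) fun i _ => ?_
    simp only [Pi.one_apply, Nat.card_Icc, Nat.add_sub_cancel]
    exact Nat.floor_le (Real.rpow_nonneg hH0.le _)
  set s : (Fin q → ℕ) → ℝ := fun h =>
    ‖∑ n ∈ Finset.Ioc ⌊a⌋ ⌊b - ∑ i, (h i : ℝ)⌋, e (fdiff q f h n)‖ with hs
  set t : (Fin q → ℕ) → ℝ := fun h => ∑ d ∈ Finset.Icc 1 ⌊H⌋₊,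
    ‖∑ n ∈ Finset.Ioc ⌊a⌋ ⌊b - ∑ i, ((Fin.snoc h d : Fin (q + 1) → ℕ) i : ℝ)⌋,
      e (fdiff (q + 1) f (Fin.snoc h d : Fin (q + 1) → ℕ) n)‖ with ht
  have hst : ∀ h, s h ^ 2 ≤ (4 * L ^ 2 + 4 * L * t h) / H := by
    intro h
    have hsum : (0 : ℝ) ≤ ∑ i, (h i : ℝ) := Finset.sum_nonneg fun _ _ => by positivity
    have := vdc_real (fun n => e (fdiff q f h n)) (fun n => (e_zero_norm _).le) ⌊a⌋
      ⌊b - ∑ i, (h i : ℝ)⌋ L H hH1 hHI (by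
        push_cast
        have h1 := Int.floor_le (b - ∑ i, (h i : ℝ))
        have h2 := Int.lt_floor_add_one a
        linarith)
    refine this.trans (le_of_eq ?_)
    rw [ht]
    congr 3
    refine Finset.sum_congr rfl fun d _ => ?_
    rw [Fin.sum_univ_castSucc]
    simp only [Fin.snoc_castSucc, Fin.snoc_last]
    rw [← sub_sub, Int.floor_sub_natCast]
    congr 1
    refine Finset.sum_congr rfl fun n _ => ?_
    rw [fdiff_succ, e_sub_conj]
  have hcs : (∑ h ∈ D, s h) ^ 2 ≤ P * ∑ h ∈ D, s h ^ 2 :=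
    sq_sum_le_card_mul_sum_sq.trans (by gcongr)
  have hss : ∑ h ∈ D, s h ^ 2 ≤ (4 * L ^ 2 * P + 4 * L * ∑ h ∈ D, t h) / H := by
    calc _ ≤ ∑ h ∈ D, (4 * L ^ 2 + 4 * L * t h) / H := Finset.sum_le_sum fun h _ => hst h
      _ = (4 * L ^ 2 * D.card + 4 * L * ∑ h ∈ D, t h) / H := by
        rw [← Finset.sum_div, Finset.sum_add_distrib, ← Finset.mul_sum _ t,
          Finset.sum_const, nsmul_eq_mul, mul_comm (D.card : ℝ)]
      _ ≤ _ := by gcongr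
  obtain ⟨m, hm⟩ : ∃ m, 2 ^ q = m + 1 := ⟨2 ^ q - 1, by have := Nat.one_le_two_pow (n := q); omega⟩
  have hm2 : 2 ^ (q + 1) = 2 * m + 2 := by rw [pow_succ, hm]; ring
  rw [hm, hm2]
  have hm3 : 2 * m + 2 - 1 = 2 * m + 1 := by omega
  rw [hm3, Nat.add_sub_cancel]
  calc (L ^ m / P * ∑ h ∈ D, s h) ^ 2 = (L ^ m / P) ^ 2 * (∑ h ∈ D, s h) ^ 2 := by ring
    _ ≤ (L ^ m / P) ^ 2 * (P * ((4 * L ^ 2 * P + 4 * L * ∑ h ∈ D, t h) / H)) := by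
      gcongr
      exact hcs.trans (by gcongr)
    _ = _ := by
      field_simp
      ring

lemma XX_nonneg (q : ℕ) (a b H : ℝ) (hH : 0 ≤ H) (hab : a ≤ b) (f : ℝ → ℝ) :
    0 ≤ XX q a b H f := by
  unfold XX
  have : 0 ≤ b - a := by linarith
  have h2 : 0 ≤ ∏ i : Fin q, H ^ ((2 : ℝ) ^ (i.1 + 1) / 2 ^ q) :=
    Finset.prod_nonneg fun i _ => Real.rpow_nonneg hH _
  positivity

lemma XX_zero (a b H : ℝ) (f : ℝ → ℝ) :
    XX 0 a b H f = ‖∑ n ∈ Finset.Ioc ⌊a⌋ ⌊b⌋, e (f n)‖ := by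
  unfold XX
  have : Finset.Icc (1 : Fin 0 → ℕ)
    (fun i : Fin 0 => ⌊H ^ ((2 : ℝ) ^ (i.1 + 1) / 2 ^ 0)⌋₊) = {1} := by
    ext x
    simp [Subsingleton.elim x 1, Pi.le_def]
  rw [this]
  simp [fdiff_zero]

lemma main_strong (q : ℕ) (a b : ℝ) (hab : a < b) (f : ℝ → ℝ) :
    ∀ H : ℝ, 1 ≤ H → H ≤ b - a →
    ‖∑ n ∈ Finset.Ioc ⌊a⌋ ⌊b⌋, e (f n)‖ ^ (2 ^ (q + 1)) ≤
      8 ^ (2 ^ (q + 1) - 1) * ((b - a) ^ (2 ^ (q + 1)) / H + XX (q + 1) a b H f / 2) := by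
  induction q with
  | zero =>
    intro H h1 h2
    have := core 0 a b H h1 h2 f
    rw [XX_zero] at this
    have h3 : 0 ≤ (b - a) ^ (2 ^ (0 + 1)) / H := by
      have : 0 ≤ b - a := by linarith
      positivity
    norm_num at this h3 ⊢
    linarith
  | succ q ih =>
    intro H h1 h2
    have hs1 : 1 ≤ √H := Real.one_le_sqrt.mpr h1
    have hs2 : √H ≤ b - a := (Real.sqrt_le_iff.mpr ⟨by linarith, by nlinarith⟩ : √H ≤ H).trans h2
    have hI := ih (√H) hs1 hs2
    have hC := core (q + 1) a b H h1 h2 f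
    have hX := XX_nonneg (q + 1 + 1) a b H (by linarith) hab.le f
    set S := ‖∑ n ∈ Finset.Ioc ⌊a⌋ ⌊b⌋, e (f n)‖ with hS
    have hS0 : 0 ≤ S := norm_nonneg _
    obtain ⟨m, hm⟩ : ∃ m, 2 ^ (q + 1) = m + 1 :=
      ⟨2 ^ (q + 1) - 1, by have := Nat.one_le_two_pow (n := q + 1); omega⟩
    have hm2 : 2 ^ (q + 1 + 1) = 2 * m + 2 := by rw [pow_succ, hm]; ring
    rw [hm] at hI
    rw [hm2] at hC ⊢
    rw [Nat.add_sub_cancel] at hI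
    rw [show 2 * m + 2 - 1 = 2 * m + 1 by omega]
    have hA : ((b - a) ^ (m + 1) / √H) ^ 2 = (b - a) ^ (2 * m + 2) / H := by
      rw [div_pow, Real.sq_sqrt (by linarith)]
      ring
    set A := (b - a) ^ (m + 1) / √H
    set X := XX (q + 1) a b (√H) f
    rw [← hA] at hC ⊢
    set Y := XX (q + 1 + 1) a b H f
    have hp : (0 : ℝ) < 8 ^ (2 * m) := by positivity
    calc S ^ (2 * m + 2) = (S ^ (m + 1)) ^ 2 := by ring
      _ ≤ (8 ^ m * (A + X / 2)) ^ 2 := by gcongr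
      _ = 8 ^ (2 * m) * (A + X / 2) ^ 2 := by ring
      _ ≤ 8 ^ (2 * m) * (8 * (A ^ 2 + Y / 2)) := by
        gcongr
        nlinarith [sq_nonneg (A - X / 2), sq_nonneg A]
      _ = _ := by ring

theorem weyl_vdc_iteration (q : ℕ) (hq : 0 < q) (a b : ℝ) (hab : a < b)
    (H : ℝ) (hH1 : 1 ≤ H) (hHI : H ≤ b - a) (f : ℝ → ℝ) :
    ‖∑ n ∈ Finset.Ioc ⌊a⌋ ⌊b⌋, e (f n)‖ ^ (2 ^ q) ≤
      8 ^ (2 ^ q - 1) *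
        ((b - a) ^ (2 ^ q) / H +
          (b - a) ^ (2 ^ q - 1) / (∏ i : Fin q, H ^ ((2 : ℝ) ^ (i.1 + 1) / 2 ^ q)) *
            ∑ h ∈ Finset.Icc (1 : Fin q → ℕ)
                (fun i : Fin q => ⌊H ^ ((2 : ℝ) ^ (i.1 + 1) / 2 ^ q)⌋₊),
              ‖∑ n ∈ Finset.Ioc ⌊a⌋ ⌊b - ∑ i, (h i : ℝ)⌋, e (fdiff q f h n)‖) := by
  obtain ⟨r, rfl⟩ : ∃ r, q = r + 1 := ⟨q - 1, by omega⟩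
  have h := main_strong r a b hab f H hH1 hHI
  have hX := XX_nonneg (r + 1) a b H (by linarith) hab.le f
  refine h.trans ?_
  change _ ≤ 8 ^ (2 ^ (r + 1) - 1) * ((b - a) ^ (2 ^ (r + 1)) / H + XX (r + 1) a b H f)
  gcongr
  linarith
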